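/- arXiv:math/0612641 — 5 statements merged into one kernel-verified Lean document; each statement's English description precedes it below -/
import Mathlib

section
/- The operators ā and b̄ on ℓ²(ℕ×ℕ) satisfy the defining relations of the coordinate algebra A(SU_q(2)): b̄ ā = q ā b̄, b̄* ā = q ā b̄*, b̄ b̄* = b̄* b̄, ā* ā + q² b̄* b̄ = 1, and ā ā* + b̄ b̄* = 1. (This is the Hopf tensor product of the representations π₋ and π₊ of A(SU_q(2)).) -/
open scoped InnerProductSpace in
theorem HilbertBasis.ext_inner_left {ι 𝕜 E : Type*} [RCLike 𝕜] [NormedAddCommGroup E]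
    [InnerProductSpace 𝕜 E] (e : HilbertBasis ι 𝕜 E) {v w : E}
    (h : ∀ i, ⟪e i, v⟫_𝕜 = ⟪e i, w⟫_𝕜) : v = w := by
  apply e.repr.injective
  ext i
  simpa only [e.repr_apply_apply] using h i

theorem HilbertBasis.continuousLinearMap_ext {ι 𝕜 E F : Type*} [RCLike 𝕜]
    [NormedAddCommGroup E] [InnerProductSpace 𝕜 E] [NormedAddCommGroup F] [NormedSpace 𝕜 F]
    (e : HilbertBasis ι 𝕜 E) {S T : E →L[𝕜] F} (h : ∀ i, S (e i) = T (e i)) : S = T := by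
  refine ContinuousLinearMap.ext_on (s := Set.range e) ?_ ?_
  · simp [dense_iff_closure_eq, ← Submodule.topologicalClosure_coe]
  · rintro _ ⟨i, rfl⟩
    exact h i

/-- **The operators `ā`, `b̄` satisfy the defining relations of `A(SU_q(2))`.**

Fix `0 < q < 1`.  On the Hilbert space `ℓ²(ℕ×ℕ)` with standard orthonormal (Hilbert) basis
`(e (x,y))`, let `ā` and `b̄` be the bounded operators determined by
`ā e_{x,y} = √(1-q^(2x+2))√(1-q^(2y+2)) e_{x+1,y+1} + q^(x+y+1) e_{x,y}` and
`b̄ e_{x,y} = q^y √(1-q^(2x+2)) e_{x+1,y} - q^x √(1-q^(2y)) e_{x,y-1}` (the last term has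
coefficient `√(1-q^0) = 0` when `y = 0`, and `y - 1` is truncated subtraction).
Then `b̄ ā = q ā b̄`, `b̄* ā = q ā b̄*`, `b̄ b̄* = b̄* b̄`, `ā* ā + q² b̄* b̄ = 1` and
`ā ā* + b̄ b̄* = 1`. -/
theorem SUq2_relations_for_abar_bbar
    {H : Type*} [NormedAddCommGroup H] [InnerProductSpace ℂ H] [CompleteSpace H]
    (e : HilbertBasis (ℕ × ℕ) ℂ H)
    (q : ℝ) (hq0 : 0 < q) (hq1 : q < 1)
    (abar bbar : H →L[ℂ] H)
    (ha : ∀ x y : ℕ, abar (e (x, y)) =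
      ((Real.sqrt (1 - q ^ (2 * x + 2)) * Real.sqrt (1 - q ^ (2 * y + 2)) : ℝ) : ℂ)
          • e (x + 1, y + 1)
        + ((q ^ (x + y + 1) : ℝ) : ℂ) • e (x, y))
    (hb : ∀ x y : ℕ, bbar (e (x, y)) =
      ((q ^ y * Real.sqrt (1 - q ^ (2 * x + 2)) : ℝ) : ℂ) • e (x + 1, y)
        - ((q ^ x * Real.sqrt (1 - q ^ (2 * y)) : ℝ) : ℂ) • e (x, y - 1)) :
    bbar * abar = (q : ℂ) • (abar * bbar) ∧
    ContinuousLinearMap.adjoint bbar * abar = (q : ℂ) • (abar * ContinuousLinearMap.adjoint bbar) ∧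
    bbar * ContinuousLinearMap.adjoint bbar = ContinuousLinearMap.adjoint bbar * bbar ∧
    ContinuousLinearMap.adjoint abar * abar
        + (q : ℂ) ^ 2 • (ContinuousLinearMap.adjoint bbar * bbar) = 1 ∧
    abar * ContinuousLinearMap.adjoint abar + bbar * ContinuousLinearMap.adjoint bbar = 1 := by
  obtain ⟨s, hs⟩ : ∃ s : ℕ → ℝ, ∀ n, s n = Real.sqrt (1 - q ^ (2 * n)) := ⟨_, fun _ ↦ rfl⟩
  have s_zero : s 0 = 0 := by simp [hs]
  have s_sq (n : ℕ) : (s n : ℂ) ^ 2 = 1 - ((q : ℂ) ^ n) ^ 2 := by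
    have hn : 0 ≤ 1 - q ^ (2 * n) := sub_nonneg.2 (pow_le_one₀ hq0.le hq1.le)
    rw [← pow_mul, mul_comm n 2]
    exact_mod_cast (hs n) ▸ Real.sq_sqrt hn
  have ha' (x y : ℕ) : abar (e (x, y)) =
      ((s (x + 1) : ℂ) * s (y + 1)) • e (x + 1, y + 1) + ((q : ℂ) ^ (x + y + 1)) • e (x, y) := by
    rw [ha, hs, hs]
    push_cast
    rfl
  have hb' (x y : ℕ) : bbar (e (x, y)) =
      ((q : ℂ) ^ y * s (x + 1)) • e (x + 1, y) - ((q : ℂ) ^ x * s y) • e (x, y - 1) := by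
    rw [hb, hs, hs]
    push_cast
    rfl
  have inner_e (i j : ℕ × ℕ) : inner ℂ (e i) (e j) = if i = j then (1 : ℂ) else 0 :=
    orthonormal_iff_ite.1 e.orthonormal i j
  have ha_adj (x y : ℕ) : ContinuousLinearMap.adjoint abar (e (x, y)) =
      ((s x : ℂ) * s y) • e (x - 1, y - 1) + ((q : ℂ) ^ (x + y + 1)) • e (x, y) := by
    refine e.ext_inner_left fun ⟨u, v⟩ ↦ ?_
    rw [ContinuousLinearMap.adjoint_inner_right, ha']
    simp only [inner_add_left, inner_add_right, inner_smul_left, inner_smul_right, inner_e,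
      map_mul, map_pow, Complex.conj_ofReal, Prod.mk.injEq]
    rcases x with _ | x <;> rcases y with _ | y <;> rcases u with _ | u <;>
      rcases v with _ | v <;>
      simp only [s_zero, Nat.add_sub_cancel, Nat.zero_sub, Complex.ofReal_zero, mul_zero, zero_mul,
        zero_add, Nat.add_right_cancel_iff] <;>
      clear ha hb hs s_sq ha' hb' inner_e <;> grind
  have hb_adj (x y : ℕ) : ContinuousLinearMap.adjoint bbar (e (x, y)) =
      ((q : ℂ) ^ y * s x) • e (x - 1, y) - ((q : ℂ) ^ x * s (y + 1)) • e (x, y + 1) := by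
    refine e.ext_inner_left fun ⟨u, v⟩ ↦ ?_
    rw [ContinuousLinearMap.adjoint_inner_right, hb']
    simp only [inner_sub_left, inner_sub_right, inner_smul_left, inner_smul_right, inner_e,
      map_mul, map_pow, Complex.conj_ofReal, Prod.mk.injEq]
    rcases x with _ | x <;> rcases y with _ | y <;> rcases u with _ | u <;>
      rcases v with _ | v <;>
      simp only [s_zero, Nat.add_sub_cancel, Nat.zero_sub, Complex.ofReal_zero, mul_zero, zero_mul,
        zero_add, sub_zero, Nat.add_right_cancel_iff] <;>
      clear ha hb hs s_sq ha' hb' ha_adj inner_e <;> grind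
  refine ⟨?_, ?_, ?_, ?_, ?_⟩ <;>
  · refine e.continuousLinearMap_ext fun ⟨x, y⟩ ↦ ?_
    have hx := s_sq x
    have hy := s_sq y
    have hx' := s_sq (x + 1)
    have hy' := s_sq (y + 1)
    rcases x with _ | x <;> rcases y with _ | y <;>
      simp only [mul_apply_eq_comp, add_apply, smul_apply, one_apply_eq_self, ha', hb', ha_adj,
        hb_adj, map_zero, map_add, map_sub, map_smul, s_zero, Nat.add_sub_cancel,
        Complex.ofReal_zero, mul_zero, zero_mul, zero_smul, zero_add, add_zero, sub_zero, tsub_self] <;>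
      match_scalars <;>
      clear ha hb hs s_sq s_zero ha' hb' ha_adj hb_adj inner_e hq0 hq1 <;> grind
end

section
/- The 2×2 operator matrix U = [[ā, b̄], [−q b̄*, ā*]], acting as a bounded operator on ℓ²(ℕ×ℕ) ⊕ ℓ²(ℕ×ℕ), is unitary: U* U = 1 and U U* = 1. (U is the image of the unitary representative of the generator of K₁(A(SU_q(2))).) -/
open ContinuousLinearMap in
/-- The adjoint of a `2 × 2` operator matrix is the conjugate transpose matrix. -/
theorem adjoint_apply_of_block {H : Type*} [NormedAddCommGroup H] [InnerProductSpace ℂ H]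
    [CompleteSpace H] (A B C D : H →L[ℂ] H) (U : WithLp 2 (H × H) →L[ℂ] WithLp 2 (H × H))
    (hU : ∀ v w : H, U (WithLp.toLp 2 (v, w)) = WithLp.toLp 2 (A v + B w, C v + D w)) (v w : H) :
    adjoint U (WithLp.toLp 2 (v, w)) =
      WithLp.toLp 2 (adjoint A v + adjoint C w, adjoint B v + adjoint D w) := by
  refine ext_inner_left ℂ fun p => ?_
  obtain ⟨⟨v', w'⟩⟩ := p
  rw [adjoint_inner_right, hU]
  simp only [WithLp.prod_inner_apply, inner_add_left, inner_add_right, adjoint_inner_right]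
  ring

namespace HilbertBasis

variable {ι H : Type*} [NormedAddCommGroup H] [InnerProductSpace ℂ H]

/-- Vectors with equal coefficients in a Hilbert basis are equal. -/
theorem ext_inner_basis (e : HilbertBasis ι ℂ H) {v w : H}
    (h : ∀ i, inner ℂ (e i) v = inner ℂ (e i) w) : v = w := by
  apply e.repr.injective
  ext i
  simpa only [e.repr_apply_apply] using h i

/-- Bounded operators that agree on a Hilbert basis are equal. -/
theorem continuousLinearMap_ext_s2 (e : HilbertBasis ι ℂ H) {S T : H →L[ℂ] H}
    (h : ∀ i, S (e i) = T (e i)) : S = T := by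
  refine ContinuousLinearMap.ext_on (s := Set.range e) ?_ ?_
  · rw [Submodule.dense_iff_topologicalClosure_eq_top]
    exact e.dense_span
  · rintro _ ⟨i, rfl⟩
    exact h i

theorem inner_eq_ite [DecidableEq ι] (e : HilbertBasis ι ℂ H) (i j : ι) :
    inner ℂ (e i) (e j) = if i = j then (1 : ℂ) else 0 :=
  orthonormal_iff_ite.mp e.orthonormal i j

end HilbertBasis

section QuantumSU2

open ContinuousLinearMap

variable {H : Type*} [NormedAddCommGroup H] [InnerProductSpace ℂ H]
  {s c : ℕ → ℝ} {q : ℝ} {a b : H →L[ℂ] H}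

theorem bbar_mul_abar (e : HilbertBasis (ℕ × ℕ) ℂ H) (hs0 : s 0 = 0)
    (hc : ∀ n, c (n + 1) = q * c n) (hsc : ∀ n, s n ^ 2 = 1 - c n ^ 2)
    (ha : ∀ x y : ℕ, a (e (x, y)) = ((s (x + 1) * s (y + 1) : ℝ) : ℂ) • e (x + 1, y + 1)
      + ((q * c x * c y : ℝ) : ℂ) • e (x, y))
    (hb : ∀ x y : ℕ, b (e (x, y)) = ((c y * s (x + 1) : ℝ) : ℂ) • e (x + 1, y)
      - ((c x * s y : ℝ) : ℂ) • e (x, y - 1)) :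
    b * a = (q : ℂ) • (a * b) := by
  refine e.continuousLinearMap_ext_s2 fun ⟨x, y⟩ => ?_
  have hc' (n : ℕ) : (c (n + 1) : ℂ) = q * c n := by exact_mod_cast hc n
  have hsc' (n : ℕ) : (s n : ℂ) ^ 2 = 1 - (c n : ℂ) ^ 2 := by exact_mod_cast hsc n
  have hs0' : (s 0 : ℂ) = 0 := by exact_mod_cast hs0
  simp only [mul_apply_eq_comp, smul_apply, ha, hb, map_add, map_sub, map_smul]
  clear ha hb hsc hc hs0
  rcases x with _ | x <;> rcases y with _ | y <;>
    simp only [Nat.add_sub_cancel, zero_add, Nat.zero_sub, hs0', Complex.ofReal_mul] <;>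
    match_scalars <;> grind

variable [CompleteSpace H]

theorem adjoint_abar_apply (e : HilbertBasis (ℕ × ℕ) ℂ H) (hs0 : s 0 = 0)
    (ha : ∀ x y : ℕ, a (e (x, y)) = ((s (x + 1) * s (y + 1) : ℝ) : ℂ) • e (x + 1, y + 1)
      + ((q * c x * c y : ℝ) : ℂ) • e (x, y)) (x y : ℕ) :
    adjoint a (e (x, y)) = ((s x * s y : ℝ) : ℂ) • e (x - 1, y - 1)
      + ((q * c x * c y : ℝ) : ℂ) • e (x, y) := by
  refine e.ext_inner_basis fun ⟨m, n⟩ => ?_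
  rw [adjoint_inner_right, ha]
  simp only [inner_add_left, inner_add_right, inner_smul_left, inner_smul_right,
    e.inner_eq_ite, Complex.conj_ofReal, Prod.mk.injEq]
  rcases x with _ | x <;> rcases y with _ | y <;> simp [hs0] <;> grind

theorem adjoint_bbar_apply (e : HilbertBasis (ℕ × ℕ) ℂ H) (hs0 : s 0 = 0)
    (hb : ∀ x y : ℕ, b (e (x, y)) = ((c y * s (x + 1) : ℝ) : ℂ) • e (x + 1, y)
      - ((c x * s y : ℝ) : ℂ) • e (x, y - 1)) (x y : ℕ) :
    adjoint b (e (x, y)) = ((c y * s x : ℝ) : ℂ) • e (x - 1, y)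
      - ((c x * s (y + 1) : ℝ) : ℂ) • e (x, y + 1) := by
  refine e.ext_inner_basis fun ⟨m, n⟩ => ?_
  rw [adjoint_inner_right, hb]
  simp only [inner_sub_left, inner_sub_right, inner_smul_left, inner_smul_right,
    e.inner_eq_ite, Complex.conj_ofReal, Prod.mk.injEq]
  rcases x with _ | x <;> rcases n with _ | n <;> simp [hs0] <;> grind

theorem adjoint_abar_mul_abar_add (e : HilbertBasis (ℕ × ℕ) ℂ H) (hs0 : s 0 = 0)
    (hc : ∀ n, c (n + 1) = q * c n) (hsc : ∀ n, s n ^ 2 = 1 - c n ^ 2)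
    (ha : ∀ x y : ℕ, a (e (x, y)) = ((s (x + 1) * s (y + 1) : ℝ) : ℂ) • e (x + 1, y + 1)
      + ((q * c x * c y : ℝ) : ℂ) • e (x, y))
    (hb : ∀ x y : ℕ, b (e (x, y)) = ((c y * s (x + 1) : ℝ) : ℂ) • e (x + 1, y)
      - ((c x * s y : ℝ) : ℂ) • e (x, y - 1)) :
    adjoint a * a + ((q : ℂ) ^ 2) • (b * adjoint b) = 1 := by
  refine e.continuousLinearMap_ext_s2 fun ⟨x, y⟩ => ?_
  have hc' (n : ℕ) : (c (n + 1) : ℂ) = q * c n := by exact_mod_cast hc n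
  have hsc' (n : ℕ) : (s n : ℂ) ^ 2 = 1 - (c n : ℂ) ^ 2 := by exact_mod_cast hsc n
  have hs0' : (s 0 : ℂ) = 0 := by exact_mod_cast hs0
  simp only [add_apply, mul_apply_eq_comp, smul_apply, one_apply_eq_self, ha, hb, map_add, map_sub,
    map_smul, adjoint_abar_apply e hs0 ha, adjoint_bbar_apply e hs0 hb]
  clear ha hb hsc hc hs0
  rcases x with _ | x <;> rcases y with _ | y <;>
    simp only [Nat.add_sub_cancel, zero_add, Nat.zero_sub, hs0', Complex.ofReal_mul] <;>
    match_scalars <;> grind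

theorem abar_mul_adjoint_abar_add (e : HilbertBasis (ℕ × ℕ) ℂ H) (hs0 : s 0 = 0)
    (hc : ∀ n, c (n + 1) = q * c n) (hsc : ∀ n, s n ^ 2 = 1 - c n ^ 2)
    (ha : ∀ x y : ℕ, a (e (x, y)) = ((s (x + 1) * s (y + 1) : ℝ) : ℂ) • e (x + 1, y + 1)
      + ((q * c x * c y : ℝ) : ℂ) • e (x, y))
    (hb : ∀ x y : ℕ, b (e (x, y)) = ((c y * s (x + 1) : ℝ) : ℂ) • e (x + 1, y)
      - ((c x * s y : ℝ) : ℂ) • e (x, y - 1)) :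
    a * adjoint a + b * adjoint b = 1 := by
  refine e.continuousLinearMap_ext_s2 fun ⟨x, y⟩ => ?_
  have hc' (n : ℕ) : (c (n + 1) : ℂ) = q * c n := by exact_mod_cast hc n
  have hsc' (n : ℕ) : (s n : ℂ) ^ 2 = 1 - (c n : ℂ) ^ 2 := by exact_mod_cast hsc n
  have hs0' : (s 0 : ℂ) = 0 := by exact_mod_cast hs0
  simp only [add_apply, mul_apply_eq_comp, one_apply_eq_self, ha, hb, map_add, map_sub,
    map_smul, adjoint_abar_apply e hs0 ha, adjoint_bbar_apply e hs0 hb]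
  clear ha hb hsc hc hs0
  rcases x with _ | x <;> rcases y with _ | y <;>
    simp only [Nat.add_sub_cancel, zero_add, Nat.zero_sub, hs0', Complex.ofReal_mul] <;>
    match_scalars <;> grind

theorem adjoint_bbar_mul_bbar (e : HilbertBasis (ℕ × ℕ) ℂ H) (hs0 : s 0 = 0)
    (hc : ∀ n, c (n + 1) = q * c n) (hsc : ∀ n, s n ^ 2 = 1 - c n ^ 2)
    (hb : ∀ x y : ℕ, b (e (x, y)) = ((c y * s (x + 1) : ℝ) : ℂ) • e (x + 1, y)
      - ((c x * s y : ℝ) : ℂ) • e (x, y - 1)) :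
    adjoint b * b = b * adjoint b := by
  refine e.continuousLinearMap_ext_s2 fun ⟨x, y⟩ => ?_
  have hc' (n : ℕ) : (c (n + 1) : ℂ) = q * c n := by exact_mod_cast hc n
  have hsc' (n : ℕ) : (s n : ℂ) ^ 2 = 1 - (c n : ℂ) ^ 2 := by exact_mod_cast hsc n
  have hs0' : (s 0 : ℂ) = 0 := by exact_mod_cast hs0
  simp only [mul_apply_eq_comp, hb, map_sub, map_smul, adjoint_bbar_apply e hs0 hb]
  clear hb hsc hc hs0
  rcases x with _ | x <;> rcases y with _ | y <;>
    simp only [Nat.add_sub_cancel, zero_add, Nat.zero_sub, hs0', Complex.ofReal_mul] <;>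
    match_scalars <;> grind

theorem adjoint_abar_mul_bbar (e : HilbertBasis (ℕ × ℕ) ℂ H) (hs0 : s 0 = 0)
    (hc : ∀ n, c (n + 1) = q * c n) (hsc : ∀ n, s n ^ 2 = 1 - c n ^ 2)
    (ha : ∀ x y : ℕ, a (e (x, y)) = ((s (x + 1) * s (y + 1) : ℝ) : ℂ) • e (x + 1, y + 1)
      + ((q * c x * c y : ℝ) : ℂ) • e (x, y))
    (hb : ∀ x y : ℕ, b (e (x, y)) = ((c y * s (x + 1) : ℝ) : ℂ) • e (x + 1, y)
      - ((c x * s y : ℝ) : ℂ) • e (x, y - 1)) :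
    adjoint a * b = (q : ℂ) • (b * adjoint a) := by
  refine e.continuousLinearMap_ext_s2 fun ⟨x, y⟩ => ?_
  have hc' (n : ℕ) : (c (n + 1) : ℂ) = q * c n := by exact_mod_cast hc n
  have hsc' (n : ℕ) : (s n : ℂ) ^ 2 = 1 - (c n : ℂ) ^ 2 := by exact_mod_cast hsc n
  have hs0' : (s 0 : ℂ) = 0 := by exact_mod_cast hs0
  simp only [mul_apply_eq_comp, smul_apply, hb, map_add, map_sub, map_smul,
    adjoint_abar_apply e hs0 ha]
  clear ha hb hsc hc hs0
  rcases x with _ | x <;> rcases y with _ | y <;>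
    simp only [Nat.add_sub_cancel, zero_add, Nat.zero_sub, hs0', Complex.ofReal_mul] <;>
    match_scalars <;> grind

/-- The operator matrix `[[a, b], [-q b*, a*]]` is unitary when `a` and `b` satisfy the defining
relations of `SU_q(2)`. -/
theorem unitary_of_relations (haa : adjoint a * a + ((q : ℂ) ^ 2) • (b * adjoint b) = 1)
    (haa' : a * adjoint a + b * adjoint b = 1) (hnormal : adjoint b * b = b * adjoint b)
    (hba : b * a = (q : ℂ) • (a * b)) (hab : adjoint a * b = (q : ℂ) • (b * adjoint a))
    (U : WithLp 2 (H × H) →L[ℂ] WithLp 2 (H × H))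
    (hU : ∀ v w : H, U (WithLp.toLp 2 (v, w)) =
      WithLp.toLp 2 (a v + b w, (-(q : ℂ)) • adjoint b v + adjoint a w)) :
    adjoint U * U = 1 ∧ U * adjoint U = 1 := by
  have hba' : adjoint a * adjoint b = (q : ℂ) • (adjoint b * adjoint a) := by
    simpa [← star_eq_adjoint] using congrArg star hba
  have hab' : adjoint b * a = (q : ℂ) • (a * adjoint b) := by
    simpa [← star_eq_adjoint] using congrArg star hab
  have hUadj (v w : H) : adjoint U (WithLp.toLp 2 (v, w)) =
      WithLp.toLp 2 (adjoint a v + (-(q : ℂ)) • b w, adjoint b v + a w) := by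
    have hsmul : adjoint ((-(q : ℂ)) • adjoint b) = (-(q : ℂ)) • b := by
      rw [map_smulₛₗ, adjoint_adjoint, map_neg, Complex.conj_ofReal]
    rw [adjoint_apply_of_block a b ((-(q : ℂ)) • adjoint b) (adjoint a) U hU, hsmul,
      adjoint_adjoint, smul_apply]
  have haa_apply (v : H) : adjoint a (a v) + (q : ℂ) ^ 2 • b (adjoint b v) = v :=
    DFunLike.congr_fun haa v
  have haa'_apply (v : H) : a (adjoint a v) + b (adjoint b v) = v := DFunLike.congr_fun haa' v
  have hnormal_apply (v : H) : adjoint b (b v) = b (adjoint b v) := DFunLike.congr_fun hnormal v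
  have hba_apply (v : H) : b (a v) = (q : ℂ) • a (b v) := DFunLike.congr_fun hba v
  have hab_apply (v : H) : adjoint a (b v) = (q : ℂ) • b (adjoint a v) := DFunLike.congr_fun hab v
  have hba'_apply (v : H) : adjoint a (adjoint b v) = (q : ℂ) • adjoint b (adjoint a v) :=
    DFunLike.congr_fun hba' v
  have hab'_apply (v : H) : adjoint b (a v) = (q : ℂ) • a (adjoint b v) :=
    DFunLike.congr_fun hab' v
  constructor
  · ext1 ⟨⟨v, w⟩⟩
    change adjoint U (U (WithLp.toLp 2 (v, w))) = WithLp.toLp 2 (v, w)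
    rw [hU, hUadj]
    simp only [map_add, map_smul, hab_apply, hab'_apply, hnormal_apply]
    congr 2
    · refine Eq.trans ?_ (haa_apply v)
      module
    · refine Eq.trans ?_ (haa'_apply w)
      module
  · ext1 ⟨⟨v, w⟩⟩
    change U (adjoint U (WithLp.toLp 2 (v, w))) = WithLp.toLp 2 (v, w)
    rw [hUadj, hU]
    simp only [map_add, map_smul, hba_apply, hba'_apply, hnormal_apply]
    congr 2
    · refine Eq.trans ?_ (haa'_apply v)
      module
    · refine Eq.trans ?_ (haa_apply w)
      module

end QuantumSU2

/-- **Unitarity of the generator of `K₁(A(SU_q(2)))`.**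

Fix `0 < q < 1`.  On `ℓ²(ℕ×ℕ)` with standard orthonormal (Hilbert) basis `(e (x,y))`, let
`ā`, `b̄` be the bounded operators with `ā e_{x,y} = √(1-q^(2x+2))√(1-q^(2y+2)) e_{x+1,y+1}
+ q^(x+y+1) e_{x,y}` and `b̄ e_{x,y} = q^y √(1-q^(2x+2)) e_{x+1,y} - q^x √(1-q^(2y)) e_{x,y-1}`
(last term absent when `y = 0`).  Then the 2×2 operator matrix `U = [[ā, b̄], [-q b̄*, ā*]]`,
acting on the Hilbert-space direct sum `ℓ²(ℕ×ℕ) ⊕ ℓ²(ℕ×ℕ)`, is unitary: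
`U* U = 1` and `U U* = 1`. -/
theorem K1_generator_unitary
    {H : Type*} [NormedAddCommGroup H] [InnerProductSpace ℂ H] [CompleteSpace H]
    (e : HilbertBasis (ℕ × ℕ) ℂ H)
    (q : ℝ) (hq0 : 0 < q) (hq1 : q < 1)
    (abar bbar : H →L[ℂ] H)
    (ha : ∀ x y : ℕ, abar (e (x, y)) =
      ((Real.sqrt (1 - q ^ (2 * x + 2)) * Real.sqrt (1 - q ^ (2 * y + 2)) : ℝ) : ℂ)
          • e (x + 1, y + 1)
        + ((q ^ (x + y + 1) : ℝ) : ℂ) • e (x, y))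
    (hb : ∀ x y : ℕ, bbar (e (x, y)) =
      ((q ^ y * Real.sqrt (1 - q ^ (2 * x + 2)) : ℝ) : ℂ) • e (x + 1, y)
        - ((q ^ x * Real.sqrt (1 - q ^ (2 * y)) : ℝ) : ℂ) • e (x, y - 1))
    (U : WithLp 2 (H × H) →L[ℂ] WithLp 2 (H × H))
    (hU : ∀ v w : H, U ((WithLp.equiv 2 (H × H)).symm (v, w)) =
      (WithLp.equiv 2 (H × H)).symm
        (abar v + bbar w,
         (-(q : ℂ)) • (ContinuousLinearMap.adjoint bbar v) + ContinuousLinearMap.adjoint abar w)) :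
    ContinuousLinearMap.adjoint U * U = 1 ∧ U * ContinuousLinearMap.adjoint U = 1 := by
  set s : ℕ → ℝ := fun n => Real.sqrt (1 - q ^ (2 * n)) with hs
  set c : ℕ → ℝ := fun n => q ^ n with hc_def
  have hs0 : s 0 = 0 := by simp [hs]
  have hc (n : ℕ) : c (n + 1) = q * c n := pow_succ' q n
  have hsc (n : ℕ) : s n ^ 2 = 1 - c n ^ 2 := by
    have : q ^ (2 * n) ≤ 1 := pow_le_one₀ hq0.le hq1.le
    simp only [hs, hc_def]
    rw [Real.sq_sqrt (by linarith), ← pow_mul, mul_comm n]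
  have ha' (x y : ℕ) : abar (e (x, y)) = ((s (x + 1) * s (y + 1) : ℝ) : ℂ) • e (x + 1, y + 1)
      + ((q * c x * c y : ℝ) : ℂ) • e (x, y) := by
    have hq : q * c x * c y = q ^ (x + y + 1) := by simp only [hc_def]; ring
    rw [ha, hq]
    rfl
  have hb' (x y : ℕ) : bbar (e (x, y)) = ((c y * s (x + 1) : ℝ) : ℂ) • e (x + 1, y)
      - ((c x * s y : ℝ) : ℂ) • e (x, y - 1) := hb x y
  exact unitary_of_relations (adjoint_abar_mul_abar_add e hs0 hc hsc ha' hb')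
    (abar_mul_adjoint_abar_add e hs0 hc hsc ha' hb') (adjoint_bbar_mul_bbar e hs0 hc hsc hb')
    (bbar_mul_abar e hs0 hc hsc ha' hb') (adjoint_abar_mul_bbar e hs0 hc hsc ha' hb') U hU
end

section
/- For all natural numbers d, x, y with y ≤ d, the q-number expression q^{(x+y−d)/2} · √([x+1]_q [d−y+1]_q) / ([d+1]_q [d+2]_q) equals (q^{−1} − q) · q^{y+d+2} · √((1 − q^{2x+2})(1 − q^{2d−2y+2})) / ((1 − q^{2d+2})(1 − q^{2d+4})); in particular it is bounded above by (q^{−1} − q) q^{d+2} / (1 − q²)², so that for fixed x, y it decays at least geometrically in d. (This is the off-diagonal corner coefficient of the spinor representation whose rapid decay yields trace-class commutators [F, π(x)] and ρ(ã_/) = 0.) -/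
open Real

/-- The q-integer `[N]_q = (q^(-N) - q^N)/(q⁻¹ - q)`. -/
noncomputable def qNum (q : ℝ) (N : ℕ) : ℝ := (q ^ (-(N : ℤ)) - q ^ (N : ℤ)) / (q⁻¹ - q)

/-- `[N]_q = (1 - q^(2N)) / ((q⁻¹ - q) q^N)`. -/
theorem qNum_eq_div {q : ℝ} (hq : q ≠ 0) (N : ℕ) :
    qNum q N = (1 - q ^ (2 * N)) / ((q⁻¹ - q) * q ^ N) := by
  have h : q ^ (-(N : ℤ)) - q ^ (N : ℤ) = (1 - q ^ (2 * N)) / q ^ N := by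
    rw [zpow_neg, zpow_natCast, two_mul, pow_add]
    field_simp
  rw [qNum, h, div_div, mul_comm (q ^ N)]

theorem rpow_sub_half_eq_sqrt_pow_div {q : ℝ} (hq : 0 < q) (m n : ℕ) :
    q ^ (((m : ℝ) - n) / 2) = √q ^ m / √q ^ n := by
  rw [← Real.rpow_natCast, ← Real.rpow_natCast, ← Real.rpow_sub (Real.sqrt_pos.2 hq),
    Real.sqrt_eq_rpow, ← Real.rpow_mul hq.le]
  ring_nf

theorem sqrt_qNum_mul_qNum {q : ℝ} (hq0 : 0 < q) (hq1 : q < 1) (m n : ℕ) :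
    √(qNum q m * qNum q n) =
      √((1 - q ^ (2 * m)) * (1 - q ^ (2 * n))) / ((q⁻¹ - q) * (√q ^ m * √q ^ n)) := by
  have hc : 0 < q⁻¹ - q := sub_pos.2 (hq1.trans ((one_lt_inv₀ hq0).2 hq1))
  have hr : 0 < √q := Real.sqrt_pos.2 hq0
  have hsq : ∀ k, q ^ k = (√q ^ k) ^ 2 := fun k => by
    rw [pow_right_comm, Real.sq_sqrt hq0.le]
  have h : qNum q m * qNum q n = (1 - q ^ (2 * m)) * (1 - q ^ (2 * n)) /
      ((q⁻¹ - q) * (√q ^ m * √q ^ n)) ^ 2 := by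
    rw [qNum_eq_div hq0.ne', qNum_eq_div hq0.ne', div_mul_div_comm, hsq m, hsq n]
    ring
  rw [h, Real.sqrt_div' _ (sq_nonneg _), Real.sqrt_sq (by positivity)]

theorem offdiagonal_coefficient_eq {q : ℝ} (hq0 : 0 < q) (hq1 : q < 1) (x y e : ℕ) :
    q ^ (((x : ℝ) - e) / 2) * √(qNum q (x + 1) * qNum q (e + 1)) /
        (qNum q (y + e + 1) * qNum q (y + e + 2)) =
      (q⁻¹ - q) * q ^ (y + (y + e) + 2) *
        √((1 - q ^ (2 * x + 2)) * (1 - q ^ (2 * e + 2))) /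
        ((1 - q ^ (2 * (y + e) + 2)) * (1 - q ^ (2 * (y + e) + 4))) := by
  have hc : q⁻¹ - q ≠ 0 := (sub_pos.2 (hq1.trans ((one_lt_inv₀ hq0).2 hq1))).ne'
  have hr : √q ≠ 0 := (Real.sqrt_pos.2 hq0).ne'
  have hne : ∀ k, k ≠ 0 → 1 - q ^ k ≠ 0 := fun k hk => (sub_pos.2 (pow_lt_one₀ hq0.le hq1 hk)).ne'
  have h1 := hne (2 * (y + e) + 2) (by omega)
  have h2 := hne (2 * (y + e) + 4) (by omega)
  rw [rpow_sub_half_eq_sqrt_pow_div hq0, sqrt_qNum_mul_qNum hq0 hq1,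
    qNum_eq_div hq0.ne', qNum_eq_div hq0.ne']
  have hpow : q ^ (y + e + 1) * q ^ (y + e + 2) =
      q ^ (y + (y + e) + 2) * (√q ^ e * √q ^ (e + 1) * √q) := by
    have : √q ^ e * √q ^ (e + 1) * √q = q ^ (e + 1) := by
      rw [← Real.sq_sqrt hq0.le, Real.sqrt_sq (Real.sqrt_nonneg q)]
      ring
    rw [this]
    ring
  simp only [mul_add, mul_one, Nat.reduceMul] at h1 h2 ⊢
  generalize q⁻¹ - q = c at *
  generalize √((1 - q ^ (2 * x + 2)) * (1 - q ^ (2 * e + 2))) = S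
  generalize 1 - q ^ (2 * y + 2 * e + 2) = A at *
  generalize 1 - q ^ (2 * y + 2 * e + 4) = B at *
  calc _ = c * (q ^ (y + e + 1) * q ^ (y + e + 2)) * S /
        (√q ^ e * √q ^ (e + 1) * √q * (A * B)) := by
        field_simp
        ring
    _ = _ := by
        rw [hpow]
        field_simp

theorem offdiagonal_coefficient_le {q : ℝ} (hq0 : 0 < q) (hq1 : q < 1) (x y d e : ℕ) :
    (q⁻¹ - q) * q ^ (y + d + 2) * √((1 - q ^ (2 * x + 2)) * (1 - q ^ (2 * e + 2))) /
        ((1 - q ^ (2 * d + 2)) * (1 - q ^ (2 * d + 4))) ≤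
      (q⁻¹ - q) * q ^ (d + 2) / (1 - q ^ 2) ^ 2 := by
  have hc : 0 < q⁻¹ - q := sub_pos.2 (hq1.trans ((one_lt_inv₀ hq0).2 hq1))
  have hnn : ∀ k, 0 ≤ 1 - q ^ k := fun k => sub_nonneg.2 (pow_le_one₀ hq0.le hq1.le)
  have hle : ∀ k, 1 - q ^ k ≤ 1 := fun k => sub_le_self _ (by positivity)
  have hge : ∀ k, 2 ≤ k → 1 - q ^ 2 ≤ 1 - q ^ k := fun k hk =>
    sub_le_sub_left (pow_le_pow_of_le_one hq0.le hq1.le hk) 1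
  have hpos : 0 < 1 - q ^ 2 := sub_pos.2 (pow_lt_one₀ hq0.le hq1 two_ne_zero)
  have hS : √((1 - q ^ (2 * x + 2)) * (1 - q ^ (2 * e + 2))) ≤ 1 :=
    Real.sqrt_le_one.2 (mul_le_one₀ (hle _) (hnn _) (hle _))
  refine div_le_div₀ (by positivity) ?_ (by positivity) ?_
  · calc _ ≤ (q⁻¹ - q) * q ^ (y + d + 2) * 1 := by gcongr
      _ ≤ (q⁻¹ - q) * q ^ (d + 2) := by
        rw [mul_one]
        exact mul_le_mul_of_nonneg_left
          (pow_le_pow_of_le_one hq0.le hq1.le (by omega)) hc.le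
  · rw [sq]
    exact mul_le_mul (hge _ (by omega)) (hge _ (by omega)) hpos.le (hnn _)

/-- **Off-diagonal corner coefficient of the spinor representation decays geometrically.**

Fix `0 < q < 1`.  For all `d, x, y ∈ ℕ` with `y ≤ d` (where `d = 2j`),
`q^((x+y-d)/2) √([x+1]_q [d-y+1]_q) / ([d+1]_q [d+2]_q)
  = (q⁻¹ - q) q^(y+d+2) √((1-q^(2x+2))(1-q^(2(d-y)+2))) / ((1-q^(2d+2))(1-q^(2d+4)))`,
and this quantity is bounded above by `(q⁻¹ - q) q^(d+2)/(1-q²)²`, hence decays at least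
geometrically in `d` for fixed `x`, `y`. -/
theorem spinor_offdiagonal_coefficient (q : ℝ) (hq0 : 0 < q) (hq1 : q < 1) :
    ∀ d x y : ℕ, y ≤ d →
      (q ^ (((x : ℝ) + (y : ℝ) - (d : ℝ)) / 2) * Real.sqrt (qNum q (x + 1) * qNum q (d - y + 1)) /
          (qNum q (d + 1) * qNum q (d + 2))
        = (q⁻¹ - q) * q ^ (y + d + 2) *
            Real.sqrt ((1 - q ^ (2 * x + 2)) * (1 - q ^ (2 * (d - y) + 2))) /
            ((1 - q ^ (2 * d + 2)) * (1 - q ^ (2 * d + 4)))) ∧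
      q ^ (((x : ℝ) + (y : ℝ) - (d : ℝ)) / 2) * Real.sqrt (qNum q (x + 1) * qNum q (d - y + 1)) /
          (qNum q (d + 1) * qNum q (d + 2))
        ≤ (q⁻¹ - q) * q ^ (d + 2) / (1 - q ^ 2) ^ 2 := by
  intro d x y hyd
  obtain ⟨e, rfl⟩ := Nat.exists_eq_add_of_le hyd
  have hexp : (x : ℝ) + y - ((y + e : ℕ) : ℝ) = x - e := by
    push_cast
    ring
  rw [hexp, Nat.add_sub_cancel_left, offdiagonal_coefficient_eq hq0 hq1]
  exact ⟨rfl, offdiagonal_coefficient_le hq0 hq1 x y (y + e) e⟩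
end

section
/- The function f(z) := ζ_H(z − 2; 1/2) − (1/4)·ζ_H(z; 1/2) is complex-differentiable at every point of ℂ \ {1, 3}, and lim_{z→3} (z − 3)·f(z) = 1 while lim_{z→1} (z − 1)·f(z) = −1/4. (Thus the zeta function Tr(P^↑|D|^{−z}) of the spectral triple on SU_q(2) has simple poles exactly at the points 3 and 1 of the dimension spectrum Σ = {1, 2, 3}, with residues 1 and −1/4 = τ₀^↑(1)·τ₀^↓(1).) -/
open HurwitzZeta Filter Topology

/-- The Hurwitz zeta function shifted by `c` is differentiable away from `1 + c`. -/
lemma differentiableAt_hurwitzZeta_comp_sub (a : UnitAddCircle) (c : ℂ) {s : ℂ}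
    (hs : s - c ≠ 1) : DifferentiableAt ℂ (fun w ↦ hurwitzZeta a (w - c)) s :=
  (differentiableAt_hurwitzZeta a hs).comp s (differentiableAt_id.sub_const c)

/-- The Hurwitz zeta function shifted by `c` has residue `1` at `1 + c`. -/
lemma hurwitzZeta_comp_sub_residue (a : UnitAddCircle) (c : ℂ) :
    Tendsto (fun s ↦ (s - (1 + c)) * hurwitzZeta a (s - c)) (𝓝[≠] (1 + c)) (𝓝 1) := by
  have h : Tendsto (fun s : ℂ ↦ s - c) (𝓝[≠] (1 + c)) (𝓝[≠] 1) := by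
    refine tendsto_nhdsWithin_iff.mpr ⟨Tendsto.mono_left ?_ nhdsWithin_le_nhds, ?_⟩
    · exact (continuous_sub_right c).tendsto' _ _ (add_sub_cancel_right 1 c)
    · filter_upwards [self_mem_nhdsWithin] with s hs
      simpa [sub_eq_iff_eq_add] using hs
  refine ((hurwitzZeta_residue_one a).comp h).congr fun s ↦ ?_
  simp only [Function.comp_apply]
  ring

/-- A function continuous at `z` has residue `0` there. -/
lemma tendsto_sub_mul_nhdsNE_zero {g : ℂ → ℂ} {z : ℂ} (hg : ContinuousAt g z) :
    Tendsto (fun s ↦ (s - z) * g s) (𝓝[≠] z) (𝓝 0) := by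
  have h : ContinuousAt (fun s ↦ (s - z) * g s) z := by fun_prop
  simpa using h.tendsto.mono_left nhdsWithin_le_nhds

/-- **Poles and residues of the zeta function `Tr(P^↑|D|^{-z})` of the spectral triple on
`SU_q(2)`.**

The function `f(z) = ζ_H(z-2; 1/2) - (1/4) ζ_H(z; 1/2)` (the meromorphic continuation of
`Σ_{n≥0} (n+1)(n+2)(n+3/2)^{-z}`) is complex-differentiable away from `{1, 3}`, and has
simple poles at `3` and `1` with residues `1` and `-1/4`:
`(z-3) f(z) → 1` as `z → 3` and `(z-1) f(z) → -1/4` as `z → 1`. -/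
theorem zeta_up_poles_and_residues :
    (∀ z : ℂ, z ≠ 1 → z ≠ 3 →
      DifferentiableAt ℂ
        (fun w : ℂ => hurwitzZeta ((1 / 2 : ℝ) : UnitAddCircle) (w - 2)
          - (1 / 4) * hurwitzZeta ((1 / 2 : ℝ) : UnitAddCircle) w) z) ∧
    Tendsto
      (fun z : ℂ => (z - 3) *
        (hurwitzZeta ((1 / 2 : ℝ) : UnitAddCircle) (z - 2)
          - (1 / 4) * hurwitzZeta ((1 / 2 : ℝ) : UnitAddCircle) z))
      (𝓝[≠] (3 : ℂ)) (𝓝 1) ∧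
    Tendsto
      (fun z : ℂ => (z - 1) *
        (hurwitzZeta ((1 / 2 : ℝ) : UnitAddCircle) (z - 2)
          - (1 / 4) * hurwitzZeta ((1 / 2 : ℝ) : UnitAddCircle) z))
      (𝓝[≠] (1 : ℂ)) (𝓝 (-1 / 4)) := by
  refine ⟨fun z h1 h3 ↦ ?_, ?_, ?_⟩
  · refine (differentiableAt_hurwitzZeta_comp_sub _ 2 fun h ↦ h3 ?_).sub
      ((differentiableAt_hurwitzZeta _ h1).const_mul _)
    linear_combination h
  · have hpole := hurwitzZeta_comp_sub_residue ((1 / 2 : ℝ) : UnitAddCircle) 2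
    have hreg := tendsto_sub_mul_nhdsNE_zero (z := 3)
      (differentiableAt_hurwitzZeta ((1 / 2 : ℝ) : UnitAddCircle) (by norm_num)).continuousAt
    rw [show (1 + 2 : ℂ) = 3 by norm_num] at hpole
    convert! hpole.sub (hreg.const_mul (1 / 4)) using 2
    · ring
    · norm_num
  · have hpole := hurwitzZeta_residue_one ((1 / 2 : ℝ) : UnitAddCircle)
    have hreg := tendsto_sub_mul_nhdsNE_zero (z := 1) (differentiableAt_hurwitzZeta_comp_sub
      ((1 / 2 : ℝ) : UnitAddCircle) 2 (by norm_num)).continuousAt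
    convert! hreg.sub (hpole.const_mul (1 / 4)) using 2
    · ring
    · norm_num
end

section
/- Define e : I → ℝ by e(d,x,y,↑) = d + 3/2 and e(d,x,y,↓) = −(d + 1/2). Then: (i) for every integer n ≥ 1, the fiber e^{−1}(n + 1/2) has exactly n(n+1) elements and the fiber e^{−1}(−(n + 1/2)) has exactly n(n+1) elements; (ii) every value of e is of the form n + 1/2 or −(n + 1/2) for some integer n ≥ 1. Hence the spectrum of the Dirac operator D of the spectral triple on SU_q(2), with multiplicities, coincides with that of the classical Dirac operator on the round 3-sphere S³ (eigenvalues ±(n + 1/2), n ≥ 1, each with multiplicity n(n+1)). -/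
/-- The index set of the spinor basis `v^j_{x,y,s}` of the isospectral spectral triple on
`SU_q(2)`: quadruples `(d, x, y, s)` with `d = 2j ∈ ℕ`, `x ≤ d`, `s = ↑` (`true`) forcing
`y ≤ d + 1`, and `s = ↓` (`false`) forcing `y + 1 ≤ d` (i.e. `y ≤ d - 1`). -/
def SpinorIndex : Type :=
  {p : ℕ × ℕ × ℕ × Bool //
    p.2.1 ≤ p.1 ∧ (p.2.2.2 = true → p.2.2.1 ≤ p.1 + 1) ∧ (p.2.2.2 = false → p.2.2.1 + 1 ≤ p.1)}

/-- The Dirac eigenvalue of the isospectral spectral triple on `SU_q(2)`: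
`e(d,x,y,↑) = d + 3/2` and `e(d,x,y,↓) = -(d + 1/2)`. -/
noncomputable def diracEigenvalue (i : SpinorIndex) : ℝ :=
  if i.1.2.2.2 = true then (i.1.1 : ℝ) + 3 / 2 else -((i.1.1 : ℝ) + 1 / 2)

theorem diracEigenvalue_eq_add_half_iff (i : SpinorIndex) (n : ℕ) :
    diracEigenvalue i = (n : ℝ) + 1 / 2 ↔ i.1.2.2.2 = true ∧ i.1.1 + 1 = n := by
  unfold diracEigenvalue
  have hd : (0 : ℝ) ≤ i.1.1 := Nat.cast_nonneg _
  have hn : (0 : ℝ) ≤ n := Nat.cast_nonneg _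
  split_ifs with h
  · rw [← @Nat.cast_inj ℝ]
    push_cast
    exact ⟨fun e => ⟨h, by linarith⟩, fun e => by linarith [e.2]⟩
  · exact ⟨fun e => by linarith, fun e => absurd e.1 h⟩

theorem diracEigenvalue_eq_neg_add_half_iff (i : SpinorIndex) (n : ℕ) :
    diracEigenvalue i = -((n : ℝ) + 1 / 2) ↔ i.1.2.2.2 = false ∧ i.1.1 = n := by
  unfold diracEigenvalue
  have hd : (0 : ℝ) ≤ i.1.1 := Nat.cast_nonneg _
  have hn : (0 : ℝ) ≤ n := Nat.cast_nonneg _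
  split_ifs with h
  · exact ⟨fun e => by linarith, fun e => by simp [h] at e⟩
  · rw [← @Nat.cast_inj ℝ]
    exact ⟨fun e => ⟨by simpa using h, by linarith⟩, fun e => by linarith [e.2]⟩

/-- The spin-up indices with `d + 1 = n` are parametrized by `x < n` and `y < n + 1`. -/
def spinUpEquiv (n : ℕ) :
    {i : SpinorIndex // i.1.2.2.2 = true ∧ i.1.1 + 1 = n} ≃ Fin n × Fin (n + 1) where
  toFun i :=
    (⟨i.1.1.2.1, by have := i.1.2.1; have := i.2.2; omega⟩,
      ⟨i.1.1.2.2.1, by have := i.1.2.2.1 i.2.1; have := i.2.2; omega⟩)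
  invFun p :=
    ⟨⟨(n - 1, p.1, p.2, true), by
      have := p.1.2
      have := p.2.2
      refine ⟨?_, fun _ => ?_, fun h => by simp at h⟩ <;> dsimp only <;> omega⟩,
      rfl, by have := p.1.2; dsimp only; omega⟩
  left_inv := by
    rintro ⟨⟨⟨d, x, y, s⟩, h⟩, hs, hd⟩
    dsimp only at hs hd
    subst hs hd
    rfl
  right_inv _ := rfl

/-- The spin-down indices with `d = n` are parametrized by `y < n` and `x < n + 1`. -/
def spinDownEquiv (n : ℕ) :
    {i : SpinorIndex // i.1.2.2.2 = false ∧ i.1.1 = n} ≃ Fin n × Fin (n + 1) where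
  toFun i :=
    (⟨i.1.1.2.2.1, by have := i.1.2.2.2 i.2.1; have := i.2.2; omega⟩,
      ⟨i.1.1.2.1, by have := i.1.2.1; have := i.2.2; omega⟩)
  invFun p :=
    ⟨⟨(n, p.2, p.1, false), by
      have := p.1.2
      have := p.2.2
      refine ⟨?_, fun h => by simp at h, fun _ => ?_⟩ <;> dsimp only <;> omega⟩, rfl, rfl⟩
  left_inv := by
    rintro ⟨⟨⟨d, x, y, s⟩, h⟩, hs, hd⟩
    dsimp only at hs hd
    subst hs hd
    rfl
  right_inv _ := rfl

/-- **The Dirac spectrum of `SU_q(2)` coincides with the classical one on `S³`.**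

(i) For every `n ≥ 1`, the fibers of `diracEigenvalue` over `n + 1/2` and over `-(n + 1/2)`
each have exactly `n(n+1)` elements; (ii) every value of `diracEigenvalue` is of the form
`n + 1/2` or `-(n + 1/2)` for some `n ≥ 1`.  Hence the spectrum with multiplicities is that
of the classical Dirac operator on the round `S³`. -/
theorem dirac_spectrum_isospectral :
    (∀ n : ℕ, 1 ≤ n →
      Nat.card {i : SpinorIndex // diracEigenvalue i = (n : ℝ) + 1 / 2} = n * (n + 1) ∧
      Nat.card {i : SpinorIndex // diracEigenvalue i = -((n : ℝ) + 1 / 2)} = n * (n + 1)) ∧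
    (∀ i : SpinorIndex, ∃ n : ℕ, 1 ≤ n ∧
      (diracEigenvalue i = (n : ℝ) + 1 / 2 ∨ diracEigenvalue i = -((n : ℝ) + 1 / 2))) := by
  simp only [diracEigenvalue_eq_add_half_iff, diracEigenvalue_eq_neg_add_half_iff]
  refine ⟨fun n _ => ⟨?_, ?_⟩, fun i => ?_⟩
  · simp [Nat.card_congr (spinUpEquiv n)]
  · simp [Nat.card_congr (spinDownEquiv n)]
  · cases hs : i.1.2.2.2 with
    | true => exact ⟨i.1.1 + 1, by omega, Or.inl ⟨rfl, rfl⟩⟩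
    | false => exact ⟨i.1.1, by have := i.2.2.2 hs; omega, Or.inr ⟨rfl, rfl⟩⟩
end
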